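/- Let A and B be real symmetric positive definite n×n matrices of quasiseparable rank at most k_A and k_B respectively, with both spectra contained in [a,b], 0 < a < b. Let X solve the Sylvester equation AX + XB = C, where C has quasiseparable rank at most k_C. Set k = k_A + k_B + k_C and ρ = exp(π² / (2·log(4b/a))). Then for every off-diagonal block Y of X (i.e., Y = X[p+1:n, 1:p] or Y = X[1:p, p+1:n] for some 1 ≤ p < n) and every ℓ ≥ 1, there exists a matrix M of rank at most k·ℓ such that ‖Y − M‖₂ ≤ 4·ρ^(−2ℓ)·‖Y‖₂. -/

import Mathlib

open Matrix

/-- The spectral norm (operator 2-norm) of a matrix. -/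
noncomputable def specNorm {𝕜 : Type*} [RCLike 𝕜] {m n : ℕ}
    (M : Matrix (Fin m) (Fin n) 𝕜) : ℝ :=
  ‖LinearMap.toContinuousLinearMap (Matrix.toEuclideanLin M)‖

/-- The lower off-diagonal block `A[p+1:n, 1:p]` (1-based indexing). -/
def lowerBlock {α : Type*} {n : ℕ} (A : Matrix (Fin n) (Fin n) α) (p : ℕ) (hp : p < n) :
    Matrix (Fin (n - p)) (Fin p) α :=
  A.submatrix (fun i => ⟨p + i.1, by have := i.2; omega⟩) (fun j => ⟨j.1, by have := j.2; omega⟩)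

/-- The upper off-diagonal block `A[1:p, p+1:n]` (1-based indexing). -/
def upperBlock {α : Type*} {n : ℕ} (A : Matrix (Fin n) (Fin n) α) (p : ℕ) (hp : p < n) :
    Matrix (Fin p) (Fin (n - p)) α :=
  A.submatrix (fun i => ⟨i.1, by have := i.2; omega⟩) (fun j => ⟨p + j.1, by have := j.2; omega⟩)

/-- `A` has lower quasiseparable rank at most `k`: every submatrix contained entirely in the
strictly lower triangular part has rank at most `k`. -/
def LowerQSRankLE {𝕜 : Type*} [Field 𝕜] {n : ℕ} (A : Matrix (Fin n) (Fin n) 𝕜) (k : ℕ) : Prop :=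
  ∀ (u v : ℕ) (r : Fin u → Fin n) (c : Fin v → Fin n),
    (∀ i j, (c j : ℕ) < (r i : ℕ)) → (A.submatrix r c).rank ≤ k

/-- `A` has upper quasiseparable rank at most `k`: every submatrix contained entirely in the
strictly upper triangular part has rank at most `k`. -/
def UpperQSRankLE {𝕜 : Type*} [Field 𝕜] {n : ℕ} (A : Matrix (Fin n) (Fin n) 𝕜) (k : ℕ) : Prop :=
  ∀ (u v : ℕ) (r : Fin u → Fin n) (c : Fin v → Fin n),
    (∀ i j, (r i : ℕ) < (c j : ℕ)) → (A.submatrix r c).rank ≤ k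

/-- `A` has quasiseparable rank at most `k`. -/
def QSRankLE {𝕜 : Type*} [Field 𝕜] {n : ℕ} (A : Matrix (Fin n) (Fin n) 𝕜) (k : ℕ) : Prop :=
  LowerQSRankLE A k ∧ UpperQSRankLE A k

section Helpers
open Filter Topology

/-- Theta series with nome `q`. -/
noncomputable def thT (q : ℝ) (z : ℂ) : ℂ := ∑' n : ℤ, (q : ℂ) ^ (n ^ 2) * z ^ n

lemma thT_term_eq {q : ℝ} {t : ℝ} (hq : q = Real.exp (-Real.pi * t)) (x : ℂ) (n : ℤ) :
    (q : ℂ) ^ (n ^ 2) * (Complex.exp (2 * Real.pi * Complex.I * x)) ^ n =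
      jacobiTheta₂_term n x (Complex.I * t) := by
  rw [jacobiTheta₂_term, hq, Complex.ofReal_exp, ← Complex.exp_int_mul, ← Complex.exp_int_mul,
    ← Complex.exp_add]
  congr 1
  push_cast
  linear_combination (-(Real.pi : ℂ) * n ^ 2 * t) * Complex.I_mul_I

lemma thT_eq_jacobi {q : ℝ} {t : ℝ} (hq : q = Real.exp (-Real.pi * t)) (x : ℂ) :
    thT q (Complex.exp (2 * Real.pi * Complex.I * x)) = jacobiTheta₂ x (Complex.I * t) := by
  unfold thT jacobiTheta₂
  exact tsum_congr fun n => thT_term_eq hq x n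

lemma exists_nome {q : ℝ} (h0 : 0 < q) (h1 : q < 1) :
    ∃ t : ℝ, 0 < t ∧ q = Real.exp (-Real.pi * t) := by
  refine ⟨-Real.log q / Real.pi, ?_, ?_⟩
  · have := Real.log_neg h0 h1
    have := Real.pi_pos
    apply div_pos <;> linarith
  · have := Real.pi_pos.ne'
    rw [show -Real.pi * (-Real.log q / Real.pi) = Real.log q by field_simp, Real.exp_log h0]

lemma exists_cexp {z : ℂ} (hz : z ≠ 0) : ∃ x : ℂ, z = Complex.exp (2 * Real.pi * Complex.I * x) := by
  refine ⟨Complex.log z / (2 * Real.pi * Complex.I), ?_⟩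
  rw [mul_div_cancel₀ _ Complex.two_pi_I_ne_zero, Complex.exp_log hz]

lemma thT_summable {q : ℝ} (h0 : 0 < q) (h1 : q < 1) {z : ℂ} (hz : z ≠ 0) :
    Summable fun n : ℤ => (q : ℂ) ^ (n ^ 2) * z ^ n := by
  obtain ⟨t, ht, hq⟩ := exists_nome h0 h1
  obtain ⟨x, hx⟩ := exists_cexp hz
  subst hx
  simp_rw [thT_term_eq hq]
  rw [summable_jacobiTheta₂_term_iff]
  simpa using ht

lemma prod_lower {q : ℝ} (h0 : 0 < q) (h1 : q < 1) :
    ∃ δ : ℝ, 0 < δ ∧ Tendsto (fun n => ∏ i ∈ Finset.range n, (1 - q ^ (i + 1))) atTop (𝓝 δ) ∧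
      ∀ n, δ ≤ ∏ i ∈ Finset.range n, (1 - q ^ (i + 1)) := by
  have hs : Summable (fun i : ℕ => -q ^ (i + 1)) :=
    (((summable_nat_add_iff 1).2 (summable_geometric_of_lt_one h0.le h1))).neg
  have hs' : Summable (fun i : ℕ => ‖-q ^ (i + 1)‖) := hs.norm
  have hlt : ∀ i : ℕ, q ^ (i + 1) < 1 := fun i => pow_lt_one₀ h0.le h1 (by omega)
  have hne := tprod_one_add_ne_zero_of_summable (f := fun i : ℕ => -q ^ (i + 1))
    (fun i => by have := hlt i; exact ne_of_gt (by linarith)) hs'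
  have ht := (multipliable_one_add_of_summable hs').hasProd.tendsto_prod_nat
  simp only [← sub_eq_add_neg] at hne ht
  have hanti : Antitone (fun n => ∏ i ∈ Finset.range n, (1 - q ^ (i + 1))) := by
    apply antitone_nat_of_succ_le
    intro n
    rw [Finset.prod_range_succ]
    apply mul_le_of_le_one_right
    · exact Finset.prod_nonneg fun i _ => by linarith [hlt i]
    · linarith [pow_pos h0 (n + 1)]
  have hle := hanti.le_of_tendsto ht
  refine ⟨_, lt_of_le_of_ne ?_ hne.symm, ht, hle⟩
  exact ge_of_tendsto' ht fun n => Finset.prod_nonneg fun i _ => by linarith [hlt i]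

/-- finite Pochhammer products -/
noncomputable def thD (q : ℝ) (n : ℕ) : ℝ := ∏ i ∈ Finset.range n, (1 - (q ^ 2) ^ (i + 1))

noncomputable def thID (q : ℝ) (m : ℤ) : ℝ := if m < 0 then 0 else 1 / thD q m.toNat

lemma thD_pos {q : ℝ} (h0 : 0 < q) (h1 : q < 1) (n : ℕ) : 0 < thD q n := by
  apply Finset.prod_pos
  intro i _
  have : (q ^ 2) ^ (i + 1) < 1 := pow_lt_one₀ (by positivity) (by nlinarith) (by omega)
  linarith

lemma thID_rec {q : ℝ} (h0 : 0 < q) (h1 : q < 1) (m : ℤ) :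
    thID q (m - 1) = (1 - q ^ (2 * m)) * thID q m := by
  unfold thID
  rcases lt_trichotomy m 0 with h | h | h
  · rw [if_pos (by omega), if_pos h]; simp
  · subst h; simp
  · obtain ⟨k, rfl⟩ : ∃ k : ℕ, m = k + 1 := ⟨(m - 1).toNat, by omega⟩
    rw [if_neg (by omega), if_neg (by omega)]
    have e1 : ((k : ℤ) + 1 - 1).toNat = k := by omega
    have e2 : ((k : ℤ) + 1).toNat = k + 1 := by omega
    rw [e1, e2]
    have hk := thD_pos h0 h1 k
    have hk1 := thD_pos h0 h1 (k + 1)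
    have : thD q (k + 1) = thD q k * (1 - q ^ (2 * ((k : ℤ) + 1))) := by
      rw [thD, Finset.prod_range_succ, ← thD]
      congr 2
      rw [← pow_mul]
      norm_cast
    rw [this] at hk1 ⊢
    have h3 : (1 - q ^ (2 * ((k : ℤ) + 1))) ≠ 0 := (pos_of_mul_pos_right hk1 hk.le).ne'
    field_simp

noncomputable def thc (q : ℝ) (n : ℕ) (j : ℤ) : ℝ :=
  q ^ (j ^ 2) * thD q (2 * n) * thID q (n - j) * thID q (n + j)

lemma thc_rec {q : ℝ} (h0 : 0 < q) (h1 : q < 1) (n : ℕ) (j : ℤ) :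
    thc q (n + 1) j = (1 + q ^ (4 * n + 2)) * thc q n j +
      q ^ (2 * n + 1) * (thc q n (j - 1) + thc q n (j + 1)) := by
  unfold thc
  have hD : thD q (2 * (n + 1)) = thD q (2 * n) * (1 - q ^ (4 * n + 2)) * (1 - q ^ (4 * n + 4)) := by
    rw [show 2 * (n + 1) = 2 * n + 1 + 1 by ring, thD, Finset.prod_range_succ,
      Finset.prod_range_succ, ← thD, ← pow_mul, ← pow_mul]
    ring_nf
  have hne := h0.ne'
  rw [hD]
  push_cast
  have r1 := thID_rec h0 h1 (n + 1 - j)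
  have r2 := thID_rec h0 h1 (n + 1 + j)
  have r3 := thID_rec h0 h1 (n + j)
  have r4 := thID_rec h0 h1 (n - j)
  rw [show (n : ℤ) + 1 - j - 1 = n - j by ring] at r1
  rw [show (n : ℤ) + 1 + j - 1 = n + j by ring] at r2
  rw [show (n : ℤ) - (j - 1) = n + 1 - j by ring, show (n : ℤ) + (j - 1) = n + j - 1 by ring,
    show (n : ℤ) - (j + 1) = n - j - 1 by ring, show (n : ℤ) + (j + 1) = n + 1 + j by ring,
    r3, r4, r1, r2]
  have hx : q ^ (4 * n + 4) = (q ^ (2 * n + 2)) ^ 2 := by rw [← pow_mul]; ring_nf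
  have hx2 : q ^ (4 * n + 2) = (q ^ (2 * n + 2)) ^ 2 / q ^ 2 := by
    rw [← hx]; field_simp; ring
  have hx3 : q ^ (2 * n + 1) = q ^ (2 * n + 2) / q := by field_simp; ring
  have hz1 : q ^ (2 * ((n : ℤ) + 1 - j)) = q ^ (2 * n + 2) / q ^ (2 * j) := by
    rw [← zpow_natCast, ← zpow_sub₀ hne]; congr 1; push_cast; ring
  have hz2 : q ^ (2 * ((n : ℤ) + 1 + j)) = q ^ (2 * n + 2) * q ^ (2 * j) := by
    rw [← zpow_natCast, ← zpow_add₀ hne]; congr 1; push_cast; ring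
  have hz3 : q ^ (2 * ((n : ℤ) + j)) = q ^ (2 * n + 2) * q ^ (2 * j) / q ^ 2 := by
    rw [← zpow_natCast, ← zpow_natCast, ← zpow_add₀ hne, ← zpow_sub₀ hne]
    congr 1; push_cast; ring
  have hz4 : q ^ (2 * ((n : ℤ) - j)) = q ^ (2 * n + 2) / q ^ (2 * j) / q ^ 2 := by
    rw [← zpow_natCast, ← zpow_natCast, ← zpow_sub₀ hne, ← zpow_sub₀ hne]
    congr 1; push_cast; ring
  have hj1 : q ^ ((j - 1) ^ 2) = q ^ (j ^ 2) / q ^ (2 * j) * q := by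
    nth_rewrite 4 [← zpow_one q]
    rw [← zpow_sub₀ hne, ← zpow_add₀ hne]; congr 1; ring
  have hj2 : q ^ ((j + 1) ^ 2) = q ^ (j ^ 2) * q ^ (2 * j) * q := by
    nth_rewrite 4 [← zpow_one q]
    rw [← zpow_add₀ hne, ← zpow_add₀ hne]; congr 1; ring
  rw [hx2, hx3, hx, hz1, hz2, hz3, hz4, hj1, hj2]
  have hw : q ^ (2 * j) ≠ 0 := zpow_ne_zero _ hne
  generalize q ^ (2 * j) = w at *
  generalize q ^ (2 * n + 2) = x at *
  generalize thID q (n + 1 - j) = α at *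
  generalize thID q (n + 1 + j) = β at *
  generalize thD q (2 * n) = D at *
  generalize q ^ (j ^ 2) = J at *
  field_simp
  ring

/-- partial products of the triple product -/
noncomputable def thP (q : ℝ) (n : ℕ) (z : ℂ) : ℂ :=
  ∏ i ∈ Finset.range n, ((1 + z * (q : ℂ) ^ (2 * i + 1)) * (1 + z⁻¹ * (q : ℂ) ^ (2 * i + 1)))

lemma thP_hasSum {q : ℝ} (h0 : 0 < q) (h1 : q < 1) {z : ℂ} (hz : z ≠ 0) (n : ℕ) :
    HasSum (fun j : ℤ => (thc q n j : ℂ) * z ^ j) (thP q n z) := by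
  induction n with
  | zero =>
    have h := hasSum_ite_eq (0 : ℤ) (1 : ℂ)
    convert h using 2 with j
    · rcases lt_trichotomy j 0 with hj | hj | hj
      · simp [thc, thID, hj, hj.ne]
      · subst hj; simp [thc, thID, thD]
      · simp [thc, thID, hj, hj.ne']
    · simp [thP]
  | succ n ih =>
    have s1 : HasSum (fun j : ℤ => (thc q n (j - 1) : ℂ) * z ^ (j - 1)) (thP q n z) :=
      ((Equiv.subRight (1 : ℤ)).hasSum_iff (f := fun j : ℤ => (thc q n j : ℂ) * z ^ j)
        (a := thP q n z)).2 ih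
    have s2 : HasSum (fun j : ℤ => (thc q n (j + 1) : ℂ) * z ^ (j + 1)) (thP q n z) :=
      ((Equiv.addRight (1 : ℤ)).hasSum_iff (f := fun j : ℤ => (thc q n j : ℂ) * z ^ j)
        (a := thP q n z)).2 ih
    have s := ((ih.mul_left (1 + (q : ℂ) ^ (4 * n + 2))).add
      ((s1.mul_left ((q : ℂ) ^ (2 * n + 1) * z)).add
        (s2.mul_left ((q : ℂ) ^ (2 * n + 1) * z⁻¹))))
    have e1 : (fun j : ℤ => (thc q (n + 1) j : ℂ) * z ^ j) = fun j : ℤ =>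
        (1 + (q : ℂ) ^ (4 * n + 2)) * ((thc q n j : ℂ) * z ^ j) +
        ((q : ℂ) ^ (2 * n + 1) * z * ((thc q n (j - 1) : ℂ) * z ^ (j - 1)) +
          (q : ℂ) ^ (2 * n + 1) * z⁻¹ * ((thc q n (j + 1) : ℂ) * z ^ (j + 1))) := by
      funext j
      rw [thc_rec h0 h1, zpow_sub₀ hz, zpow_add₀ hz, zpow_one]
      push_cast
      generalize z ^ j = y
      generalize (thc q n j : ℂ) = c0
      generalize (thc q n (j - 1) : ℂ) = c1
      generalize (thc q n (j + 1) : ℂ) = c2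
      generalize (q : ℂ) ^ (4 * n + 2) = x1
      generalize (q : ℂ) ^ (2 * n + 1) = x2
      field_simp
    have e2 : thP q (n + 1) z = (1 + (q : ℂ) ^ (4 * n + 2)) * thP q n z +
        ((q : ℂ) ^ (2 * n + 1) * z * thP q n z + (q : ℂ) ^ (2 * n + 1) * z⁻¹ * thP q n z) := by
      rw [thP, Finset.prod_range_succ, ← thP, show 4 * n + 2 = (2 * n + 1) * 2 by ring, pow_mul]
      generalize (q : ℂ) ^ (2 * n + 1) = x2
      field_simp
      ring
    rw [e1, e2]
    exact s

lemma thD_lim {q : ℝ} (h0 : 0 < q) (h1 : q < 1) :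
    ∃ δ : ℝ, 0 < δ ∧ Tendsto (thD q) atTop (𝓝 δ) ∧ ∀ n, δ ≤ thD q n :=
  prod_lower (q := q ^ 2) (by positivity) (by nlinarith)

lemma triple_product {q : ℝ} (h0 : 0 < q) (h1 : q < 1) :
    ∃ c : ℝ, 0 < c ∧ ∀ z : ℂ, z ≠ 0 →
      Tendsto (fun n => thP q n z) atTop (𝓝 (c * thT q z)) := by
  obtain ⟨δ, hδ, hlim, hle⟩ := thD_lim h0 h1
  refine ⟨1 / δ, by positivity, fun z hz => ?_⟩
  have hID : ∀ m, 0 ≤ thID q m ∧ thID q m ≤ 1 / δ := by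
    intro m
    unfold thID
    split_ifs
    · exact ⟨le_rfl, by positivity⟩
    · exact ⟨by have := thD_pos h0 h1 m.toNat; positivity,
        one_div_le_one_div_of_le hδ (hle _)⟩
  have hD1 : ∀ n, thD q n ≤ 1 := by
    intro n
    apply Finset.prod_le_one
    · intro i _
      have : (q ^ 2) ^ (i + 1) < 1 := pow_lt_one₀ (by positivity) (by nlinarith) (by omega)
      linarith
    · intro i _
      have : 0 < (q ^ 2) ^ (i + 1) := by positivity
      linarith
  have key := tendsto_tsum_of_dominated_convergence
    (f := fun (n : ℕ) (j : ℤ) => (thc q n j : ℂ) * z ^ j)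
    (g := fun j : ℤ => ((1 / δ : ℝ) : ℂ) * ((q : ℂ) ^ (j ^ 2) * z ^ j)) (𝓕 := atTop)
    (bound := fun j : ℤ => (1 / δ * (1 / δ)) * ‖(q : ℂ) ^ (j ^ 2) * z ^ j‖)
    ((thT_summable h0 h1 hz).norm.mul_left _) ?_ ?_
  · rw [tsum_mul_left] at key
    refine key.congr fun n => (thP_hasSum h0 h1 hz n).tsum_eq
  · intro j
    have hl : ∀ k : ℤ, Tendsto (fun n : ℕ => thID q (n + k)) atTop (𝓝 (1 / δ)) := by
      intro k
      have h2 : Tendsto (fun n : ℕ => ((n : ℤ) + k).toNat) atTop atTop := by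
        rw [tendsto_atTop]
        intro b
        filter_upwards [eventually_ge_atTop (b + k.natAbs)] with n hn
        omega
      have h3 := (tendsto_const_nhds (x := (1 : ℝ))).div (hlim.comp h2) hδ.ne'
      refine h3.congr' ?_
      filter_upwards [eventually_ge_atTop k.natAbs] with n hn
      simp only [Function.comp, thID, Pi.div_apply]
      rw [if_neg (by omega)]
    have hd : Tendsto (fun n : ℕ => thD q (2 * n)) atTop (𝓝 δ) :=
      hlim.comp (tendsto_id.const_mul_atTop' (by norm_num))
    have ht : Tendsto (fun n : ℕ => thc q n j) atTop (𝓝 (q ^ (j ^ 2) * δ * (1 / δ) * (1 / δ))) := by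
      unfold thc
      simp only [sub_eq_add_neg]
      exact ((hd.const_mul _).mul (hl (-j))).mul (hl j)
    have ht2 := ((Complex.continuous_ofReal.tendsto _).comp ht).mul_const (z ^ j)
    have e : ((1 / δ : ℝ) : ℂ) * ((q : ℂ) ^ (j ^ 2) * z ^ j) =
        ((q ^ (j ^ 2) * δ * (1 / δ) * (1 / δ) : ℝ) : ℂ) * z ^ j := by
      have : (δ : ℂ) ≠ 0 := by exact_mod_cast hδ.ne'
      push_cast
      field_simp
    rw [e]
    exact ht2
  · refine Eventually.of_forall fun n j => ?_
    rw [norm_mul, norm_mul, ← mul_assoc]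
    apply mul_le_mul_of_nonneg_right _ (norm_nonneg _)
    have h3 := hID (n - j)
    have h4 := hID (n + j)
    have h5 := thD_pos h0 h1 (2 * n)
    have h6 : 0 < q ^ (j ^ 2) := zpow_pos h0 _
    have : ‖(q : ℂ) ^ (j ^ 2)‖ = q ^ (j ^ 2) := by
      rw [norm_zpow, Complex.norm_real, Real.norm_of_nonneg h0.le]
    rw [this, Complex.norm_real, Real.norm_eq_abs, thc, abs_of_nonneg
      (mul_nonneg (mul_nonneg (by positivity) h3.1) h4.1)]
    calc q ^ (j ^ 2) * thD q (2 * n) * thID q (n - j) * thID q (n + j)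
        = q ^ (j ^ 2) * (thD q (2 * n) * (thID q (n - j) * thID q (n + j))) := by ring
      _ ≤ q ^ (j ^ 2) * (1 * (1 / δ * (1 / δ))) := by
        gcongr
        · exact mul_nonneg h3.1 h4.1
        · exact hD1 _
        · exact h4.1
        · exact h3.2
        · exact h4.2
      _ = _ := by ring

open Matrix Filter Topology
lemma thT_mul {q : ℝ} (h0 : 0 < q) (h1 : q < 1) {u w : ℂ} (hu : u ≠ 0) (hw : w ≠ 0) :
    HasSum (fun x : ℤ × ℤ => ((q : ℂ) ^ (x.1 ^ 2) * u ^ x.1) * ((q : ℂ) ^ (x.2 ^ 2) * w ^ x.2))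
      (thT q u * thT q w) := by
  have s1 := (thT_summable h0 h1 hu).norm
  have s2 := (thT_summable h0 h1 hw).norm
  have h := (summable_mul_of_summable_norm s1 s2).hasSum
  rwa [← tsum_mul_tsum_of_summable_norm s1 s2] at h

lemma thT_add_formula {q : ℝ} (h0 : 0 < q) (h1 : q < 1) {u w : ℂ} (hu : u ≠ 0) (hw : w ≠ 0) :
    thT q u * thT q (-w) + thT q (-u) * thT q w =
      2 * (thT (q ^ 2) (-(u * w)) * thT (q ^ 2) (-(u / w))) := by
  have hq : (q : ℂ) ≠ 0 := by exact_mod_cast h0.ne'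
  have hl := (thT_mul h0 h1 hu (neg_ne_zero.2 hw)).add (thT_mul h0 h1 (neg_ne_zero.2 hu) hw)
  have hr := (thT_mul (q := q ^ 2) (by positivity) (by nlinarith)
    (neg_ne_zero.2 (mul_ne_zero hu hw)) (neg_ne_zero.2 (div_ne_zero hu hw))).mul_left 2
  rw [← hl.tsum_eq, ← hr.tsum_eq]
  have hinj : Function.Injective (fun x : ℤ × ℤ => (x.1 + x.2, x.1 - x.2)) := by
    rintro ⟨a, b⟩ ⟨c, d⟩ h
    simp only [Prod.mk.injEq] at h ⊢
    omega
  rw [← hinj.tsum_eq]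
  · apply tsum_congr
    rintro ⟨s, t⟩
    simp only
    rw [← neg_one_mul w, ← neg_one_mul u, ← neg_one_mul (u * w), ← neg_one_mul (u / w)]
    simp only [mul_zpow, div_zpow, Complex.ofReal_pow, zpow_add₀ hu, zpow_sub₀ hw]
    have e1 : (q : ℂ) ^ ((s + t) ^ 2) * (q : ℂ) ^ ((s - t) ^ 2) =
        ((q : ℂ) ^ 2) ^ (s ^ 2) * ((q : ℂ) ^ 2) ^ (t ^ 2) := by
      rw [← zpow_natCast, ← _root_.zpow_mul, ← _root_.zpow_mul, ← zpow_add₀ hq, ← zpow_add₀ hq]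
      congr 1; push_cast; ring
    have e2 : (-1 : ℂ) ^ (s + t) = (-1) ^ s * (-1) ^ t := zpow_add₀ (by norm_num) _ _
    have e3 : (-1 : ℂ) ^ (s - t) = (-1) ^ s * (-1) ^ t := by
      rw [zpow_sub₀ (by norm_num), div_eq_mul_inv, ← _root_.inv_zpow]; norm_num
    rw [e2, e3]
    linear_combination (2 * (-1) ^ s * (-1) ^ t * u ^ s * u ^ t * (w ^ s / w ^ t)) * e1
  · rintro ⟨m, n⟩ hx
    by_contra hc
    apply hx
    have hpar : Odd (m + n) := by
      rw [← Int.not_even_iff_odd]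
      rintro ⟨s, hs⟩
      exact hc ⟨(s, m - s), by ext <;> simp <;> omega⟩
    simp only
    rw [← neg_one_mul w, ← neg_one_mul u]
    simp only [mul_zpow]
    have e : (-1 : ℂ) ^ m = - (-1) ^ n := by
      rcases Int.even_or_odd n with h | h
      · rw [h.neg_one_zpow, (show Odd m by grind).neg_one_zpow]
      · rw [h.neg_one_zpow, (show Even m by grind).neg_one_zpow]; norm_num
    rw [e]
    ring

lemma thT_sub_formula {q : ℝ} (h0 : 0 < q) (h1 : q < 1) {u w : ℂ} (hu : u ≠ 0) (hw : w ≠ 0) :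
    thT q u * thT q (-w) - thT q (-u) * thT q w =
      2 * q * u * (thT (q ^ 2) (-(q ^ 2 * (u * w))) * thT (q ^ 2) (-(q ^ 2 * (u / w)))) := by
  have hq : (q : ℂ) ≠ 0 := by exact_mod_cast h0.ne'
  have hq2 : (q : ℂ) ^ 2 ≠ 0 := pow_ne_zero _ hq
  have hl := (thT_mul h0 h1 hu (neg_ne_zero.2 hw)).sub (thT_mul h0 h1 (neg_ne_zero.2 hu) hw)
  have hr := (thT_mul (q := q ^ 2) (by positivity) (by nlinarith)
    (neg_ne_zero.2 (mul_ne_zero hq2 (mul_ne_zero hu hw)))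
    (neg_ne_zero.2 (mul_ne_zero hq2 (div_ne_zero hu hw)))).mul_left (2 * q * u)
  rw [← hl.tsum_eq, ← hr.tsum_eq]
  have hinj : Function.Injective (fun x : ℤ × ℤ => (x.1 + x.2 + 1, x.1 - x.2)) := by
    rintro ⟨a, b⟩ ⟨c, d⟩ h
    simp only [Prod.mk.injEq] at h ⊢
    omega
  rw [← hinj.tsum_eq]
  · apply tsum_congr
    rintro ⟨s, t⟩
    simp only
    rw [← neg_one_mul w, ← neg_one_mul u, ← neg_one_mul ((q : ℂ) ^ 2 * (u * w)),
      ← neg_one_mul ((q : ℂ) ^ 2 * (u / w))]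
    simp only [mul_zpow, div_zpow, Complex.ofReal_pow, zpow_add₀ hu, zpow_sub₀ hw, zpow_one]
    have e1 : (q : ℂ) ^ ((s + t + 1) ^ 2) * (q : ℂ) ^ ((s - t) ^ 2) =
        q * (((q : ℂ) ^ 2) ^ (s ^ 2) * ((q : ℂ) ^ 2) ^ (t ^ 2) * ((q : ℂ) ^ 2) ^ s *
          ((q : ℂ) ^ 2) ^ t) := by
      have : (q : ℂ) = (q : ℂ) ^ (1 : ℤ) := by simp
      nth_rewrite 3 [this]
      rw [← zpow_natCast, ← _root_.zpow_mul, ← _root_.zpow_mul, ← _root_.zpow_mul, ← _root_.zpow_mul, ← zpow_add₀ hq,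
        ← zpow_add₀ hq, ← zpow_add₀ hq, ← zpow_add₀ hq, ← zpow_add₀ hq]
      congr 1; push_cast; ring
    have e2 : (-1 : ℂ) ^ (s + t + 1) = - ((-1) ^ s * (-1) ^ t) := by
      rw [zpow_add₀ (by norm_num), zpow_add₀ (by norm_num)]; simp
    have e3 : (-1 : ℂ) ^ (s - t) = (-1) ^ s * (-1) ^ t := by
      rw [zpow_sub₀ (by norm_num), div_eq_mul_inv, ← _root_.inv_zpow]; norm_num
    rw [e2, e3]
    linear_combination (2 * (-1) ^ s * (-1) ^ t * u ^ s * u ^ t * u * (w ^ s / w ^ t)) * e1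
  · rintro ⟨m, n⟩ hx
    by_contra hc
    apply hx
    have hpar : Even (m + n) := by
      rw [← Int.not_odd_iff_even]
      rintro ⟨s, hs⟩
      exact hc ⟨(s, m - s - 1), by ext <;> simp <;> omega⟩
    simp only
    rw [← neg_one_mul w, ← neg_one_mul u]
    simp only [mul_zpow]
    have e : (-1 : ℂ) ^ m = (-1) ^ n := by
      rcases Int.even_or_odd n with h | h
      · rw [h.neg_one_zpow, (show Even m by grind).neg_one_zpow]
      · rw [h.neg_one_zpow, (show Odd m by grind).neg_one_zpow]
    rw [e]
    ring

lemma thP_unit {q : ℝ} {u : ℂ} (hu : ‖u‖ = 1) (n : ℕ) :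
    thP q n u = ((∏ i ∈ Finset.range n,
      (1 + 2 * q ^ (2 * i + 1) * u.re + (q ^ (2 * i + 1)) ^ 2) : ℝ) : ℂ) := by
  rw [thP, Complex.ofReal_prod]
  apply Finset.prod_congr rfl
  intro i _
  rw [Complex.inv_eq_conj hu]
  have h1 : u * (starRingEnd ℂ) u = 1 := by
    rw [Complex.mul_conj, Complex.normSq_eq_norm_sq, hu]; simp
  have h2 : u + (starRingEnd ℂ) u = 2 * u.re := by
    rw [Complex.add_conj]; push_cast; ring
  push_cast
  linear_combination ((q : ℂ) ^ (2 * i + 1)) ^ 2 * h1 + (q : ℂ) ^ (2 * i + 1) * h2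

lemma re_bounds {u : ℂ} (hu : ‖u‖ = 1) : -1 ≤ u.re ∧ u.re ≤ 1 := by
  have := Complex.abs_re_le_norm u
  rw [hu] at this
  exact abs_le.1 this

lemma fac_nonneg {y c : ℝ} (hy : 0 < y) (hc : -1 ≤ c) : 0 ≤ 1 + 2 * y * c + y ^ 2 := by
  nlinarith [sq_nonneg (1 - y), mul_nonneg hy.le (neg_le_iff_add_nonneg.1 hc)]

lemma thT_unit {q : ℝ} (h0 : 0 < q) (h1 : q < 1) :
    ∃ c : ℝ, 0 < c ∧ ∀ u : ℂ, ‖u‖ = 1 → ∃ θ : ℝ, 0 < θ ∧ thT q u = θ ∧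
      Tendsto (fun n => ∏ i ∈ Finset.range n,
      (1 + 2 * q ^ (2 * i + 1) * u.re + (q ^ (2 * i + 1)) ^ 2)) atTop (𝓝 (c * θ)) := by
  obtain ⟨c, hc, hlim⟩ := triple_product h0 h1
  refine ⟨c, hc, fun u hu => ?_⟩
  have hu0 : u ≠ 0 := by rintro rfl; simp at hu
  have h := hlim u hu0
  have hre := (Complex.continuous_re.tendsto _).comp h
  have him := (Complex.continuous_im.tendsto _).comp h
  simp only [Function.comp_def, thP_unit hu, Complex.ofReal_re, Complex.ofReal_im,
    Complex.re_ofReal_mul, Complex.im_ofReal_mul] at hre him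
  have him0 : (thT q u).im = 0 := by
    have := tendsto_nhds_unique him tendsto_const_nhds
    rcases mul_eq_zero.1 this with h | h
    · exact absurd h hc.ne'
    · exact h
  refine ⟨(thT q u).re, ?_, ?_, hre⟩
  · obtain ⟨δ, hδ, -, hle⟩ := prod_lower h0 h1
    have : δ ^ 2 ≤ c * (thT q u).re := by
      apply ge_of_tendsto' hre
      intro n
      calc δ ^ 2 ≤ (∏ i ∈ Finset.range n, (1 - q ^ (i + 1))) ^ 2 := by gcongr; exact hle n
        _ = ∏ i ∈ Finset.range n, (1 - q ^ (i + 1)) ^ 2 := by rw [Finset.prod_pow]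
        _ ≤ _ := by
          apply Finset.prod_le_prod
          · intro i _; positivity
          · intro i _
            have hy : q ^ (2 * i + 1) ≤ q ^ (i + 1) := pow_le_pow_of_le_one h0.le h1.le (by omega)
            have hy1 : q ^ (i + 1) ≤ 1 := pow_le_one₀ h0.le h1.le
            have hy0 : 0 < q ^ (2 * i + 1) := by positivity
            have := (re_bounds hu).1
            nlinarith
    exact pos_of_mul_pos_right (lt_of_lt_of_le (by positivity) this) hc.le
  · apply Complex.ext <;> simp [him0]

lemma thT_mono {q : ℝ} (h0 : 0 < q) (h1 : q < 1) {u : ℂ} (hu : ‖u‖ = 1) :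
    ∃ α β A B : ℝ, 0 < α ∧ 0 < β ∧ 0 < A ∧ 0 < B ∧ thT q u = α ∧ thT q (-u) = β ∧ thT q 1 = A ∧
      thT q (-1) = B ∧ α * B ≤ β * A ∧ β * B ≤ α * A := by
  obtain ⟨c, hc, H⟩ := thT_unit h0 h1
  obtain ⟨α, hα, eα, lα⟩ := H u hu
  obtain ⟨β, hβ, eβ, lβ⟩ := H (-u) (by simpa using hu)
  obtain ⟨A, hA, eA, lA⟩ := H 1 (by simp)
  obtain ⟨B, hB, eB, lB⟩ := H (-1) (by simp)
  refine ⟨α, β, A, B, hα, hβ, hA, hB, eα, eβ, eA, eB, ?_, ?_⟩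
  all_goals
    rw [← mul_le_mul_iff_right₀ (show 0 < c * c by positivity)]
  · have := le_of_tendsto_of_tendsto' (lα.mul lB) (lβ.mul lA) (fun n => by
      rw [← Finset.prod_mul_distrib, ← Finset.prod_mul_distrib]
      have := re_bounds hu
      apply Finset.prod_le_prod
      · intro i _
        have hy0 : 0 < q ^ (2 * i + 1) := by positivity
        exact mul_nonneg (fac_nonneg hy0 (re_bounds hu).1)
          (fac_nonneg hy0 (re_bounds (u := -1) (by simp)).1)
      · intro i _
        have hy0 : 0 < q ^ (2 * i + 1) := by positivity
        simp
        nlinarith [mul_nonneg hy0.le (sub_nonneg.2 this.2), mul_nonneg (mul_nonneg hy0.le (sq_nonneg (q ^ (2 * i + 1)))) (sub_nonneg.2 this.2)])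
    linarith
  · have := le_of_tendsto_of_tendsto' (lβ.mul lB) (lα.mul lA) (fun n => by
      rw [← Finset.prod_mul_distrib, ← Finset.prod_mul_distrib]
      have := re_bounds hu
      apply Finset.prod_le_prod
      · intro i _
        have hy0 : 0 < q ^ (2 * i + 1) := by positivity
        exact mul_nonneg (fac_nonneg hy0 (re_bounds (u := -u) (by simpa using hu)).1)
          (fac_nonneg hy0 (re_bounds (u := -1) (by simp)).1)
      · intro i _
        have hy0 : 0 < q ^ (2 * i + 1) := by positivity
        simp
        nlinarith [mul_nonneg hy0.le (neg_le_iff_add_nonneg.1 this.1), mul_nonneg (mul_nonneg hy0.le (sq_nonneg (q ^ (2 * i + 1)))) (neg_le_iff_add_nonneg.1 this.1)])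
    linarith

lemma thT_two {P : ℝ} (h0 : 0 < P) (h1 : P < 1) : ‖thT P P‖ ≤ 2 * ‖thT P 1‖ := by
  have hP : (P : ℂ) ≠ 0 := by exact_mod_cast h0.ne'
  have e1 : thT P 1 = ((∑' n : ℤ, P ^ (n ^ 2) : ℝ) : ℂ) := by
    rw [thT, Complex.ofReal_tsum]
    exact tsum_congr fun n => by simp
  have s1 : Summable fun n : ℤ => P ^ (n ^ 2) := by
    have := (thT_summable h0 h1 (one_ne_zero)).norm
    simpa [abs_of_pos h0] using this
  have s1' : Summable fun n : ℤ => P ^ ((n + 1) ^ 2) :=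
    ((Equiv.addRight (1 : ℤ)).summable_iff (f := fun n : ℤ => P ^ (n ^ 2))).2 s1
  have s1e : ∑' n : ℤ, P ^ ((n + 1) ^ 2) = ∑' n : ℤ, P ^ (n ^ 2) :=
    (Equiv.addRight (1 : ℤ)).tsum_eq (fun n : ℤ => P ^ (n ^ 2))
  have hpos : 0 ≤ ∑' n : ℤ, P ^ (n ^ 2) := tsum_nonneg fun n => (zpow_pos h0 _).le
  have s2 := (thT_summable h0 h1 hP).norm
  rw [e1, Complex.norm_real, Real.norm_of_nonneg hpos, two_mul]
  calc ‖thT P P‖ ≤ ∑' n : ℤ, ‖(P : ℂ) ^ (n ^ 2) * (P : ℂ) ^ n‖ := norm_tsum_le_tsum_norm s2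
    _ ≤ ∑' n : ℤ, (P ^ (n ^ 2) + P ^ ((n + 1) ^ 2)) := by
      apply s2.tsum_le_tsum _ (s1.add s1')
      intro n
      rw [← zpow_add₀ hP, norm_zpow, Complex.norm_real, Real.norm_of_nonneg h0.le]
      have p1 := zpow_pos h0 (n ^ 2)
      have p2 := zpow_pos h0 ((n + 1) ^ 2)
      rcases le_or_gt 0 n with hn | hn
      · have : P ^ (n ^ 2 + n) ≤ P ^ (n ^ 2) := zpow_le_zpow_right_of_le_one₀ h0 h1.le (by omega)
        linarith
      · have : P ^ (n ^ 2 + n) ≤ P ^ ((n + 1) ^ 2) :=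
          zpow_le_zpow_right_of_le_one₀ h0 h1.le (by nlinarith)
        linarith
    _ = _ := by rw [s1.tsum_add s1', s1e]

lemma thT_unit_ne {q : ℝ} (h0 : 0 < q) (h1 : q < 1) {u : ℂ} (hu : ‖u‖ = 1) : thT q u ≠ 0 := by
  obtain ⟨c, hc, H⟩ := thT_unit h0 h1
  obtain ⟨α, hα, eα, lα⟩ := H u hu
  rw [eα]
  exact_mod_cast hα.ne'

noncomputable def thF (P : ℝ) (u : ℂ) : ℂ := thT P (-(P * u)) / thT P (-u)

lemma thF_le {P : ℝ} (h0 : 0 < P) (h1 : P < 1) {u : ℂ} (hu : ‖u‖ = 1) : ‖thF P u‖ ≤ 2 := by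
  obtain ⟨R, hR0, hR1, rfl⟩ : ∃ R : ℝ, 0 < R ∧ R < 1 ∧ P = R ^ 2 :=
    ⟨√P, Real.sqrt_pos.2 h0, by rw [Real.sqrt_lt' one_pos]; simpa using h1,
      (Real.sq_sqrt h0.le).symm⟩
  have gen : ∀ v : ℂ, ‖v‖ = 1 → R * ‖thF (R ^ 2) v‖ ^ 2 =
      ‖thT R v * thT R (-1) - thT R (-v) * thT R 1‖ / ‖thT R v * thT R (-1) + thT R (-v) * thT R 1‖ := by
    intro v hv
    have hv0 : v ≠ 0 := by rintro rfl; simp at hv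
    have hne := thT_unit_ne h0 h1 (u := -v) (by simpa using hv)
    rw [thT_sub_formula hR0 hR1 hv0 one_ne_zero, thT_add_formula hR0 hR1 hv0 one_ne_zero, thF]
    simp only [mul_one, div_one, norm_mul, norm_div, hv, Complex.norm_real, Real.norm_of_nonneg hR0.le,
      Complex.ofReal_pow]
    have := norm_ne_zero_iff.2 hne
    field_simp
  obtain ⟨α, β, A, B, hα, hβ, hA, hB, eα, eβ, eA, eB, i1, i2⟩ := thT_mono hR0 hR1 hu
  have g1 := gen u hu
  have g2 := gen (-1) (by simp)
  rw [neg_neg] at g2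
  rw [eα, eβ, eA, eB] at g1
  rw [eA, eB] at g2
  norm_cast at g1 g2
  simp only [Real.norm_eq_abs] at g1 g2
  have hBA : B ≤ A := by nlinarith
  rw [abs_of_nonpos (by linarith), abs_of_pos (by positivity)] at g1
  rw [abs_of_nonpos (by nlinarith), abs_of_pos (by positivity)] at g2
  have hle : R * ‖thF (R ^ 2) u‖ ^ 2 ≤ R * ‖thF (R ^ 2) (-1)‖ ^ 2 := by
    push_cast at g1 g2 ⊢
    rw [g1, g2, div_le_div_iff₀ (by positivity) (by positivity)]
    nlinarith [mul_nonneg (mul_nonneg hA.le hB.le) (sub_nonneg.2 i2)]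
  have hle2 : ‖thF (R ^ 2) u‖ ≤ ‖thF (R ^ 2) (-1)‖ :=
    le_of_sq_le_sq (le_of_mul_le_mul_left hle hR0) (norm_nonneg _)
  refine hle2.trans ?_
  have h2 := thT_two h0 h1
  have hn := norm_pos_iff.2 (thT_unit_ne h0 h1 (u := 1) (by simp))
  rw [thF, norm_div]
  simp only [mul_neg, mul_one, neg_neg]
  rw [div_le_iff₀ hn]
  exact h2

lemma root_prod {N : ℕ} (hN : 0 < N) {ω : ℂ} (hω : ω ^ N = -1) (hp : IsPrimitiveRoot (ω ^ 2) N)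
    (x : ℂ) : ∏ i ∈ Finset.range N, (1 - x * ω ^ (2 * i + 1)) = 1 + x ^ N := by
  have h := X_pow_sub_C_eq_prod hp (α := x * ω) (a := (x * ω) ^ N) hN rfl
  have h2 := congrArg (Polynomial.eval 1) h
  rw [Polynomial.eval_prod] at h2
  simp only [Polynomial.eval_sub, Polynomial.eval_pow, Polynomial.eval_X, Polynomial.eval_C,
    one_pow, mul_pow, hω] at h2
  rw [show 1 + x ^ N = 1 - x ^ N * -1 by ring, h2]
  apply Finset.prod_congr rfl
  intro i _
  rw [pow_add, pow_mul]
  ring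

lemma thP_root {N : ℕ} (hN : 0 < N) {ω : ℂ} (hω : ω ^ N = -1) (hp : IsPrimitiveRoot (ω ^ 2) N)
    (q : ℝ) (z : ℂ) (n : ℕ) :
    ∏ i ∈ Finset.range N, thP q n (-(z * ω ^ (2 * i + 1))) = thP (q ^ N) n (z ^ N) := by
  unfold thP
  rw [Finset.prod_comm]
  apply Finset.prod_congr rfl
  intro k _
  rw [Finset.prod_mul_distrib]
  have h1 := root_prod hN hω hp (z * (q : ℂ) ^ (2 * k + 1))
  have h2 := root_prod hN (ω := ω⁻¹) (by rw [inv_pow, hω]; norm_num)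
    (by rw [inv_pow]; exact hp.inv) (z⁻¹ * (q : ℂ) ^ (2 * k + 1))
  rw [show (1 + z ^ N * ((q ^ N : ℝ) : ℂ) ^ (2 * k + 1)) = 1 + (z * (q : ℂ) ^ (2 * k + 1)) ^ N by
    push_cast; ring, show (1 + (z ^ N)⁻¹ * ((q ^ N : ℝ) : ℂ) ^ (2 * k + 1)) =
      1 + (z⁻¹ * (q : ℂ) ^ (2 * k + 1)) ^ N by push_cast; rw [← inv_pow]; ring, ← h1, ← h2]
  congr 1
  · apply Finset.prod_congr rfl
    intro i _
    ring
  · apply Finset.prod_congr rfl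
    intro i _
    rw [inv_neg, mul_inv, ← inv_pow]
    ring

lemma thF_prod {N : ℕ} (hN : 0 < N) {ω : ℂ} (hω : ω ^ N = -1) (hp : IsPrimitiveRoot (ω ^ 2) N)
    {q : ℝ} (h0 : 0 < q) (h1 : q < 1) {u : ℂ} (hu : ‖u‖ = 1) :
    ∏ i ∈ Finset.range N, thF q (u * ω ^ (2 * i + 1)) = thF (q ^ N) (-u ^ N) := by
  have hu0 : u ≠ 0 := by rintro rfl; simp at hu
  have hω0 : ω ≠ 0 := by rintro rfl; simp [hN.ne'] at hω
  have hq0 : (q : ℂ) ≠ 0 := by exact_mod_cast h0.ne'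
  have hωn : ‖ω‖ = 1 := by
    have := congrArg norm hω
    rw [norm_pow, norm_neg, norm_one] at this
    exact (pow_eq_one_iff_of_nonneg (norm_nonneg _) hN.ne').1 this
  obtain ⟨c, hc, H⟩ := triple_product h0 h1
  have hQ0 : 0 < q ^ N := by positivity
  have hQ1 : q ^ N < 1 := pow_lt_one₀ h0.le h1 hN.ne'
  obtain ⟨c', hc', H'⟩ := triple_product hQ0 hQ1
  have key : ∀ z : ℂ, z ≠ 0 → (c : ℂ) ^ N * ∏ i ∈ Finset.range N, thT q (-(z * ω ^ (2 * i + 1))) =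
      c' * thT (q ^ N) (z ^ N) := by
    intro z hz
    have l1 := tendsto_finsetProd (Finset.range N) (fun i _ =>
      H (-(z * ω ^ (2 * i + 1))) (neg_ne_zero.2 (mul_ne_zero hz (pow_ne_zero _ hω0))))
    simp only [thP_root hN hω hp] at l1
    have := tendsto_nhds_unique l1 (H' _ (pow_ne_zero _ hz))
    rw [← this, Finset.prod_mul_distrib]
    simp
  have k1 := key u hu0
  have k2 := key (q * u) (mul_ne_zero hq0 hu0)
  have n1 : ∏ i ∈ Finset.range N, thT q (-(u * ω ^ (2 * i + 1))) ≠ 0 := by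
    rw [Finset.prod_ne_zero_iff]
    intro i _
    exact thT_unit_ne h0 h1 (by simp [hu, hωn])
  have n2 : thT (q ^ N) (u ^ N) ≠ 0 := thT_unit_ne hQ0 hQ1 (by simp [hu])
  have hcc : (c : ℂ) ≠ 0 := by exact_mod_cast hc.ne'
  have hcc' : (c' : ℂ) ≠ 0 := by exact_mod_cast hc'.ne'
  simp only [thF]
  rw [Finset.prod_div_distrib]
  simp only [mul_neg, neg_neg]
  rw [div_eq_div_iff n1 n2]
  simp only [mul_assoc] at k2 k1 ⊢
  have e : ((q ^ N : ℝ) : ℂ) * u ^ N = (q * u) ^ N := by push_cast; ring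
  rw [e]
  apply mul_left_cancel₀ (mul_ne_zero (pow_ne_zero N hcc) hcc')
  linear_combination (c' * thT (q ^ N) (u ^ N)) * k2 - (c' * thT (q ^ N) ((q * u) ^ N)) * k1

lemma thT_functional {t : ℝ} (ht : 0 < t) :
    ‖thT (Real.exp (-Real.pi * t)) (-1)‖ ≤
      2 * Real.exp (-Real.pi / (4 * t)) * ‖thT (Real.exp (-Real.pi * t)) 1‖ := by
  have htc : (t : ℂ) ≠ 0 := by exact_mod_cast ht.ne'
  have e0 := thT_eq_jacobi (q := Real.exp (-Real.pi * t)) (t := t) rfl 0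
  have e1 := thT_eq_jacobi (q := Real.exp (-Real.pi * t)) (t := t) rfl (1 / 2)
  rw [jacobiTheta₂_functional_equation] at e0 e1
  have f0 := thT_eq_jacobi (q := Real.exp (-Real.pi * t⁻¹)) (t := t⁻¹) rfl 0
  have f1 := thT_eq_jacobi (q := Real.exp (-Real.pi * t⁻¹)) (t := t⁻¹) rfl
    (Complex.I * (1 / (2 * t)))
  have g1 : Complex.exp (2 * Real.pi * Complex.I * (1 / 2)) = -1 := by
    rw [← Complex.exp_pi_mul_I]; congr 1; ring
  have g2 : -1 / (Complex.I * t) = Complex.I * (t⁻¹ : ℝ) := by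
    push_cast; field_simp; simp
  have g3 : (1 / 2 : ℂ) / (Complex.I * t) = - (Complex.I * (1 / (2 * t))) := by
    field_simp; simp
  have g4 : Complex.exp (2 * Real.pi * Complex.I * (Complex.I * (1 / (2 * t)))) =
      (Real.exp (-Real.pi * t⁻¹) : ℝ) := by
    push_cast
    congr 1
    field_simp
    simp
  have g5 : Complex.exp (-Real.pi * Complex.I * (1 / 2) ^ 2 / (Complex.I * t)) =
      (Real.exp (-Real.pi / (4 * t)) : ℝ) := by
    push_cast
    congr 1
    field_simp
    norm_num
  rw [g1, g2, g3, jacobiTheta₂_neg_left, ← f1, g4, g5] at e1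
  rw [g2, zero_div, ← f0] at e0
  simp only [mul_zero, Complex.exp_zero] at e0
  have z0 : Complex.exp (-Real.pi * Complex.I * 0 ^ 2 / (Complex.I * t)) = 1 := by simp
  rw [z0, mul_one] at e0
  have hQ : Real.exp (-Real.pi * t⁻¹) < 1 := by
    rw [Real.exp_lt_one_iff]
    have : 0 < Real.pi * t⁻¹ := by positivity
    linarith
  have h2 := thT_two (Real.exp_pos _) hQ
  rw [e0, e1]
  simp only [norm_mul, Complex.norm_real, Real.norm_eq_abs, Real.abs_exp]
  calc _ ≤ _ := mul_le_mul_of_nonneg_left h2 (by positivity)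
    _ = _ := by ring

lemma zolotarev {a b : ℝ} (ha : 0 < a) (hab : a < b) {ρ : ℝ}
    (hρ : ρ = Real.exp (Real.pi ^ 2 / (2 * Real.log (4 * b / a)))) {l : ℕ} (hl : 1 ≤ l) :
    ∃ p : ℕ → ℝ, (∀ j, 0 < p j) ∧ ∀ x ∈ Set.Icc a b,
      |∏ j ∈ Finset.range l, ((x - p j) / (x + p j))| ≤ 2 * (ρ ^ l)⁻¹ := by
  have hb : 0 < b := ha.trans hab
  set μ := Real.log (4 * b / a) with hμ
  have hμ0 : 0 < μ := Real.log_pos (by rw [lt_div_iff₀ ha]; linarith)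
  have hpi := Real.pi_pos
  set t := Real.pi / (2 * μ) with ht
  have ht0 : 0 < t := by positivity
  set q := Real.exp (-Real.pi * t) with hq
  have hqρ : q = ρ⁻¹ := by
    rw [hρ, ← Real.exp_neg, hq, ht]; congr 1; field_simp
  have hq0 : 0 < q := Real.exp_pos _
  have hq1 : q < 1 := by
    rw [hq, Real.exp_lt_one_iff]
    have : 0 < Real.pi * t := by positivity
    linarith
  obtain ⟨c, -, H⟩ := thT_unit hq0 hq1
  -- real theta function
  let θ : ℂ → ℝ := fun u => (thT q u).re
  have hθ : ∀ u : ℂ, ‖u‖ = 1 → 0 < θ u ∧ thT q u = θ u := by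
    intro u hu
    obtain ⟨α, hα, eα, -⟩ := H u hu
    have : θ u = α := by simp [θ, eα]
    rw [this]; exact ⟨hα, eα⟩
  have hθn : ∀ u : ℂ, ‖u‖ = 1 → ‖-u‖ = 1 := fun u hu => by simpa using hu
  let g : ℂ → ℝ := fun u => θ u / θ (-u)
  have hg : ∀ u : ℂ, ‖u‖ = 1 → 0 < g u := fun u hu => div_pos (hθ u hu).1 (hθ _ (hθn u hu)).1
  let s := √(a * b)
  have hs : 0 < s := Real.sqrt_pos.2 (by positivity)
  have hss : s ^ 2 = a * b := Real.sq_sqrt (by positivity)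
  -- the roots of unity
  let N := 2 * l
  have hN : 0 < N := by omega
  let ω : ℂ := Complex.exp (Real.pi * Complex.I / N)
  have hNc : (N : ℂ) ≠ 0 := by exact_mod_cast hN.ne'
  have hω : ω ^ N = -1 := by
    rw [← Complex.exp_nat_mul, ← Complex.exp_pi_mul_I]; congr 1; field_simp
  have hωp : IsPrimitiveRoot (ω ^ 2) N := by
    have := Complex.isPrimitiveRoot_exp N hN.ne'
    convert this using 1
    rw [← Complex.exp_nat_mul]; congr 1; push_cast; ring
  have hω0 : ω ≠ 0 := Complex.exp_ne_zero _
  have hωn : ‖ω‖ = 1 := by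
    have := congrArg norm hω
    rw [norm_pow, norm_neg, norm_one] at this
    exact (pow_eq_one_iff_of_nonneg (norm_nonneg _) hN.ne').1 this
  have hwn : ∀ k : ℕ, ‖ω ^ k‖ = 1 := fun k => by simp [hωn]
  refine ⟨fun j => s * g (ω ^ (2 * j + 1)), fun j => mul_pos hs (hg _ (hwn _)), ?_⟩
  intro x hx
  -- parametrise x
  obtain ⟨u, hu, hxu⟩ : ∃ u : ℂ, ‖u‖ = 1 ∧ x = s * g u := by
    let e : ℝ → ℂ := fun r => Complex.exp (2 * Real.pi * Complex.I * r)
    have he : ∀ r, ‖e r‖ = 1 := by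
      intro r
      have : e r = Complex.exp ((2 * Real.pi * r : ℝ) * Complex.I) := by
        simp only [e]; congr 1; push_cast; ring
      rw [this, Complex.norm_exp_ofReal_mul_I]
    have hen : ∀ r : ℝ, -e r = e (r + 1 / 2) := by
      intro r
      simp only [e]
      rw [show (2 * Real.pi * Complex.I * ((r + 1 / 2 : ℝ) : ℂ)) =
        2 * Real.pi * Complex.I * r + Real.pi * Complex.I by push_cast; ring, Complex.exp_add,
        Complex.exp_pi_mul_I]
      ring
    have hcT : Continuous fun r : ℝ => θ (e r) := by
      have : (fun r : ℝ => θ (e r)) = fun r : ℝ => (jacobiTheta₂ (r : ℂ) (Complex.I * t)).re := by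
        funext r
        simp only [θ, e]
        rw [thT_eq_jacobi hq]
      rw [this]
      apply Complex.continuous_re.comp
      apply Continuous.comp (g := fun z : ℂ => jacobiTheta₂ z (Complex.I * t)) _
        Complex.continuous_ofReal
      rw [continuous_iff_continuousAt]
      intro z
      exact (differentiableAt_jacobiTheta₂_fst z (by simpa using ht0)).continuousAt
    have hcg : Continuous fun r : ℝ => s * g (e r) := by
      apply continuous_const.mul
      apply hcT.div
      · simp only [hen]
        exact hcT.comp (continuous_id.add continuous_const)
      · intro r; exact (hθ _ (hθn _ (he r))).1.ne'
    have e0 : e 0 = 1 := by simp [e]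
    have e1 : e (1 / 2) = -1 := by have := hen 0; rw [e0, zero_add] at this; exact this.symm
    obtain ⟨hA, hA'⟩ := hθ 1 (by simp)
    obtain ⟨hB, hB'⟩ := hθ (-1) (by simp)
    have hBA : θ (-1) ^ 2 * b ≤ a * θ 1 ^ 2 := by
      have hf := thT_functional ht0
      rw [← hq, hA', hB'] at hf
      simp only [Complex.norm_real, Real.norm_eq_abs, abs_of_pos hA, abs_of_pos hB] at hf
      have hex : (2 * Real.exp (-Real.pi / (4 * t))) ^ 2 = a / b := by
        rw [mul_pow, ← Real.exp_nat_mul]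
        have : ((2 : ℕ) : ℝ) * (-Real.pi / (4 * t)) = -μ := by
          rw [ht]; push_cast; field_simp; norm_num
        rw [this, Real.exp_neg, hμ, Real.exp_log (by positivity)]
        field_simp
        norm_num
      have h2 : θ (-1) ^ 2 ≤ (2 * Real.exp (-Real.pi / (4 * t)) * θ 1) ^ 2 := by gcongr
      rw [mul_pow, hex] at h2
      calc _ ≤ (a / b * θ 1 ^ 2) * b := by gcongr
        _ = _ := by field_simp
    have hg1 : g 1 = θ 1 / θ (-1) := rfl
    have hgm : g (-1) = θ (-1) / θ 1 := by simp [g]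
    have lo : s * g (e (1 / 2)) ≤ x := by
      refine le_trans ?_ hx.1
      rw [e1, hgm]
      apply le_of_sq_le_sq _ ha.le
      rw [mul_pow, hss, div_pow, ← mul_div_assoc, div_le_iff₀ (by positivity)]
      nlinarith
    have hi : x ≤ s * g (e 0) := by
      refine le_trans hx.2 ?_
      rw [e0, hg1]
      apply le_of_sq_le_sq _ (by positivity)
      rw [mul_pow, hss, div_pow, ← mul_div_assoc, le_div_iff₀ (by positivity)]
      nlinarith
    obtain ⟨r, -, hr⟩ := intermediate_value_Icc' (show (0 : ℝ) ≤ 1 / 2 by norm_num)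
      hcg.continuousOn ⟨lo, hi⟩
    exact ⟨e r, he r, hr.symm⟩
  have hu0 : u ≠ 0 := by rintro rfl; simp at hu
  have hP0 : 0 < q ^ 2 := by positivity
  have hP1 : q ^ 2 < 1 := by nlinarith
  have fac : ∀ w : ℂ, ‖w‖ = 1 → |(x - s * g w) / (x + s * g w)| =
      q * (‖thF (q ^ 2) (u * w)‖ * ‖thF (q ^ 2) (u * w⁻¹)‖) := by
    intro w hw
    have hw0 : w ≠ 0 := by rintro rfl; simp at hw
    obtain ⟨p1, r1⟩ := hθ u hu
    obtain ⟨p2, r2⟩ := hθ (-u) (hθn _ hu)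
    obtain ⟨p3, r3⟩ := hθ w hw
    obtain ⟨p4, r4⟩ := hθ (-w) (hθn _ hw)
    have h1 := thT_sub_formula hq0 hq1 hu0 hw0
    have h2 := thT_add_formula hq0 hq1 hu0 hw0
    have n1 := thT_unit_ne hP0 hP1 (u := -(u * w)) (by simp [hu, hw])
    have n2 := thT_unit_ne hP0 hP1 (u := -(u / w)) (by simp [hu, hw])
    have e1 : (x - s * g w) / (x + s * g w) =
        (θ u * θ (-w) - θ (-u) * θ w) / (θ u * θ (-w) + θ (-u) * θ w) := by
      rw [hxu]; simp only [g]
      field_simp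
    rw [e1, ← Real.norm_eq_abs, ← Complex.norm_real]
    push_cast
    rw [← r1, ← r2, ← r3, ← r4, h1, h2, thF, thF]
    simp only [norm_mul, norm_div, hu, Complex.norm_real, Real.norm_of_nonneg hq0.le,
      Complex.ofReal_pow, div_eq_mul_inv u w, Complex.norm_ofNat, mul_one] at n2 ⊢
    have := norm_ne_zero_iff.2 n1
    have := norm_ne_zero_iff.2 n2
    field_simp
  rw [Finset.abs_prod, Finset.prod_congr rfl (fun j _ => fac (ω ^ (2 * j + 1)) (hwn _)),
    Finset.prod_mul_distrib, Finset.prod_mul_distrib, Finset.prod_const, Finset.card_range]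
  have hprod := thF_prod hN hω hωp hP0 hP1 hu
  have hle : ‖thF ((q ^ 2) ^ N) (-u ^ N)‖ ≤ 2 :=
    thF_le (by positivity) (pow_lt_one₀ hP0.le hP1 hN.ne') (by simp [hu])
  rw [← hprod, norm_prod, show N = l + l by simp only [N]; ring, Finset.prod_range_add] at hle
  have hrefl : ∏ j ∈ Finset.range l, ‖thF (q ^ 2) (u * ω ^ (2 * (l + j) + 1))‖ =
      ∏ j ∈ Finset.range l, ‖thF (q ^ 2) (u * (ω ^ (2 * j + 1))⁻¹)‖ := by
    rw [← Finset.prod_range_reflect]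
    apply Finset.prod_congr rfl
    intro j hj
    have hj' := Finset.mem_range.1 hj
    congr 3
    apply eq_inv_of_mul_eq_one_left
    rw [← pow_add, show 2 * (l + (l - 1 - j)) + 1 + (2 * j + 1) = N * 2 by simp only [N]; omega,
      pow_mul, hω]
    norm_num
  rw [hrefl] at hle
  rw [hqρ] at hle ⊢
  rw [← inv_pow, mul_comm 2]
  apply mul_le_mul_of_nonneg_left hle
  rw [← hqρ]; positivity

section MatrixPart
open scoped Matrix.Norms.L2Operator

lemma rank_add_le' {m n : Type*} [Fintype m] [Fintype n] [DecidableEq n] [DecidableEq m]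
    (M N : Matrix m n ℝ) : (M + N).rank ≤ M.rank + N.rank := by
  unfold Matrix.rank
  rw [Matrix.mulVecLin_add]
  exact (Submodule.finrank_mono (LinearMap.range_add_le _ _)).trans
    (Submodule.finrank_add_le_finrank_add_finrank _ _)

lemma rank_smul_le' {m n : Type*} [Fintype m] [Fintype n] [DecidableEq n] [DecidableEq m]
    (c : ℝ) (M : Matrix m n ℝ) : (c • M).rank ≤ M.rank := by
  have : c • M = (c • (1 : Matrix m m ℝ)) * M := by simp
  rw [this]
  exact Matrix.rank_mul_le_right _ _

lemma rank_sub_le' {m n : Type*} [Fintype m] [Fintype n] [DecidableEq n] [DecidableEq m]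
    (M N : Matrix m n ℝ) : (M - N).rank ≤ M.rank + N.rank := by
  have : M - N = M + (-1 : ℝ) • N := by simp [sub_eq_add_neg]
  rw [this]
  exact (rank_add_le' _ _).trans (by gcongr; exact rank_smul_le' _ _)

lemma rank_mul_mul_le {m n : Type*} [Fintype m] [Fintype n] [DecidableEq n] [DecidableEq m]
    (S : Matrix m m ℝ) (M : Matrix m n ℝ) (T : Matrix n n ℝ) :
    (S * M * T).rank ≤ M.rank :=
  (Matrix.rank_mul_le_left _ _).trans (Matrix.rank_mul_le_right _ _)

lemma adi_step {m n : Type*} [Fintype m] [Fintype n] [DecidableEq n] [DecidableEq m]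
    (A S V : Matrix m m ℝ) (B T W : Matrix n n ℝ) (p : ℝ)
    (hV : V * A = 1 - p • V) (hW : B * W = 1 - p • W)
    (hS : S = 1 - (2 * p) • V) (hT : T = 1 - (2 * p) • W)
    (hSA : A * S = S * A) (hTB : T * B = B * T) (E : Matrix m n ℝ) {k : ℕ}
    (hk : (A * E + E * B).rank ≤ k) :
    (A * (S * E * T) + (S * E * T) * B).rank ≤ k ∧ (E - S * E * T).rank ≤ k := by
  constructor
  · have : A * (S * E * T) + (S * E * T) * B = S * (A * E + E * B) * T := by
      rw [Matrix.mul_add, Matrix.add_mul]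
      congr 1
      · rw [← Matrix.mul_assoc, ← Matrix.mul_assoc, hSA, ← Matrix.mul_assoc]
      · rw [Matrix.mul_assoc, hTB, ← Matrix.mul_assoc, ← Matrix.mul_assoc]
    rw [this]
    exact (rank_mul_mul_le _ _ _).trans hk
  · have h1 : V * (A * E + E * B) * W = E * W + V * E - (2 * p) • (V * E * W) := by
      have e1 : V * (A * E) = E - p • (V * E) := by
        rw [← Matrix.mul_assoc, hV, Matrix.sub_mul, Matrix.one_mul, Matrix.smul_mul]
      have e2 : V * (E * B) * W = V * E - p • (V * E * W) := by
        rw [← Matrix.mul_assoc, Matrix.mul_assoc, hW, Matrix.mul_sub, Matrix.mul_one,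
          Matrix.mul_smul]
      rw [Matrix.mul_add, Matrix.add_mul, e1, e2, Matrix.sub_mul, Matrix.smul_mul]
      module
    have : E - S * E * T = (2 * p) • (V * (A * E + E * B) * W) := by
      rw [h1, hS, hT]
      simp only [Matrix.sub_mul, Matrix.mul_sub, Matrix.one_mul, Matrix.mul_one, Matrix.smul_mul,
        Matrix.mul_smul]
      module
    rw [this]
    exact (rank_smul_le' _ _).trans ((rank_mul_mul_le _ _ _).trans hk)

lemma cfc_facts {m : Type*} [Fintype m] [DecidableEq m] (A : Matrix m m ℝ)
    (hA : A.IsHermitian) (hpos : ∀ x ∈ spectrum ℝ A, 0 < x) (p : ℝ) (hp : 0 < p) :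
    ∃ V : Matrix m m ℝ, V * A = 1 - p • V ∧ A * V = 1 - p • V ∧
      cfc (fun x : ℝ => (x - p) / (x + p)) A = 1 - (2 * p) • V := by
  have hc : ∀ f : ℝ → ℝ, ContinuousOn f (spectrum ℝ A) := fun f =>
    (Matrix.finite_real_spectrum (A := A)).continuousOn f
  have hsa : IsSelfAdjoint A := hA
  refine ⟨cfc (fun x : ℝ => (x + p)⁻¹) A, ?_, ?_, ?_⟩
  · conv_lhs => rw [← cfc_id' ℝ A]
    rw [cfc_id' ℝ A]
    nth_rewrite 2 [← cfc_id' ℝ A]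
    rw [← cfc_mul _ _ A (hc _) (hc _), ← cfc_one ℝ A, ← cfc_smul p _ A (hc _),
      ← cfc_sub _ _ A (hc _) (hc _)]
    refine cfc_congr fun x hx => ?_
    have := hpos x hx
    simp only [Pi.one_apply, smul_eq_mul]
    field_simp
    ring
  · nth_rewrite 1 [← cfc_id' ℝ A]
    rw [← cfc_mul _ _ A (hc _) (hc _), ← cfc_one ℝ A, ← cfc_smul p _ A (hc _),
      ← cfc_sub _ _ A (hc _) (hc _)]
    refine cfc_congr fun x hx => ?_
    have := hpos x hx
    simp only [Pi.one_apply, smul_eq_mul]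
    field_simp
    ring
  · rw [← cfc_one ℝ A, ← cfc_smul (2 * p) _ A (hc _), ← cfc_sub _ _ A (hc _) (hc _)]
    refine cfc_congr fun x hx => ?_
    have := hpos x hx
    simp only [Pi.one_apply, smul_eq_mul]
    field_simp
    ring

lemma adi_iter {m n : Type*} [Fintype m] [Fintype n] [DecidableEq n] [DecidableEq m]
    (A : Matrix m m ℝ) (B : Matrix n n ℝ) (hA : A.IsHermitian) (hB : B.IsHermitian)
    (hAp : ∀ x ∈ spectrum ℝ A, 0 < x) (hBp : ∀ x ∈ spectrum ℝ B, 0 < x)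
    (p : ℕ → ℝ) (hp : ∀ j, 0 < p j) (Y : Matrix m n ℝ) {k : ℕ}
    (hk : (A * Y + Y * B).rank ≤ k) (l : ℕ) :
    ∃ E : Matrix m n ℝ,
      E = cfc (fun x : ℝ => ∏ j ∈ Finset.range l, ((x - p j) / (x + p j))) A * Y *
        cfc (fun x : ℝ => ∏ j ∈ Finset.range l, ((x - p j) / (x + p j))) B ∧
      (A * E + E * B).rank ≤ k ∧ (Y - E).rank ≤ k * l := by
  have hsa : IsSelfAdjoint A := hA
  have hsb : IsSelfAdjoint B := hB
  have hcA : ∀ f : ℝ → ℝ, ContinuousOn f (spectrum ℝ A) := fun f =>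
    (Matrix.finite_real_spectrum (A := A)).continuousOn f
  have hcB : ∀ f : ℝ → ℝ, ContinuousOn f (spectrum ℝ B) := fun f =>
    (Matrix.finite_real_spectrum (A := B)).continuousOn f
  induction l with
  | zero =>
    refine ⟨Y, ?_, hk, by simp⟩
    simp only [Finset.range_zero, Finset.prod_empty]
    rw [cfc_const_one ℝ A, cfc_const_one ℝ B, Matrix.one_mul, Matrix.mul_one]
  | succ l ih =>
    obtain ⟨E, hE, h1, h2⟩ := ih
    obtain ⟨V, hV1, hV2, hV3⟩ := cfc_facts A hA hAp (p l) (hp l)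
    obtain ⟨W, hW1, hW2, hW3⟩ := cfc_facts B hB hBp (p l) (hp l)
    obtain ⟨h3, h4⟩ := adi_step A _ V B _ W (p l) hV1 hW2 hV3 hW3
      (by rw [hV3, Matrix.mul_sub, Matrix.sub_mul, Matrix.mul_smul, Matrix.smul_mul, hV1, hV2]
          simp)
      (by rw [hW3, Matrix.mul_sub, Matrix.sub_mul, Matrix.mul_smul, Matrix.smul_mul, hW1, hW2]
          simp) E h1
    refine ⟨_, ?_, h3, ?_⟩
    · simp only [Finset.prod_range_succ]
      rw [cfc_mul _ _ B (hcB _) (hcB _)]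
      simp only [mul_comm _ ((_ - p l) / (_ + p l))]
      rw [cfc_mul _ _ A (hcA _) (hcA _), hE]
      simp only [Matrix.mul_assoc]
    · have := rank_add_le' (Y - E) (E - cfc (fun x : ℝ => (x - p l) / (x + p l)) A * E *
        cfc (fun x : ℝ => (x - p l) / (x + p l)) B)
      rw [sub_add_sub_cancel] at this
      rw [Nat.mul_succ]
      omega

lemma specNorm_eq {m n : ℕ} (M : Matrix (Fin m) (Fin n) ℝ) : specNorm M = ‖M‖ := by
  rw [Matrix.l2_opNorm_def]; rfl

lemma spectrum_submatrix {n u : ℕ} (A : Matrix (Fin n) (Fin n) ℝ) (hA : A.IsHermitian)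
    {a b : ℝ} (hs : spectrum ℝ A ⊆ Set.Icc a b) (f : Fin u → Fin n)
    (hf : Function.Injective f) :
    spectrum ℝ (A.submatrix f f) ⊆ Set.Icc a b := by
  have h1 : (A - algebraMap ℝ _ a).PosSemidef := by
    rw [Matrix.posSemidef_iff_isHermitian_and_spectrum_nonneg]
    refine ⟨hA.sub (IsSelfAdjoint.algebraMap _ (IsSelfAdjoint.all a)), ?_⟩
    rw [← spectrum.sub_singleton_eq]
    rintro _ ⟨x, hx, y, hy, rfl⟩
    rw [Set.mem_singleton_iff] at hy
    subst hy
    simpa using (hs hx).1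
  have h2 : (algebraMap ℝ _ b - A).PosSemidef := by
    rw [Matrix.posSemidef_iff_isHermitian_and_spectrum_nonneg]
    refine ⟨Matrix.IsHermitian.sub (IsSelfAdjoint.algebraMap _ (IsSelfAdjoint.all b)) hA, ?_⟩
    rw [← spectrum.singleton_sub_eq]
    rintro _ ⟨y, hy, x, hx, rfl⟩
    rw [Set.mem_singleton_iff] at hy
    subst hy
    simpa using (hs hx).2
  have key : ∀ c : ℝ, (algebraMap ℝ (Matrix (Fin n) (Fin n) ℝ) c).submatrix f f =
      algebraMap ℝ (Matrix (Fin u) (Fin u) ℝ) c := by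
    intro c
    ext i j
    simp [Matrix.algebraMap_matrix_apply, hf.eq_iff]
  have h1' := h1.submatrix f
  have h2' := h2.submatrix f
  have e1 : (A - algebraMap ℝ _ a).submatrix f f = A.submatrix f f - algebraMap ℝ _ a := by
    rw [← key a]; rfl
  have e2 : (algebraMap ℝ _ b - A).submatrix f f = algebraMap ℝ _ b - A.submatrix f f := by
    rw [← key b]; rfl
  rw [e1, Matrix.posSemidef_iff_isHermitian_and_spectrum_nonneg,
    ← spectrum.sub_singleton_eq] at h1'
  rw [e2, Matrix.posSemidef_iff_isHermitian_and_spectrum_nonneg,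
    ← spectrum.singleton_sub_eq] at h2'
  intro x hx
  have i1 := h1'.2 ⟨x, hx, a, rfl, rfl⟩
  have i2 := h2'.2 ⟨b, rfl, x, hx, rfl⟩
  simp only [Set.mem_ofPred_eq, sub_nonneg] at i1 i2
  exact ⟨i1, i2⟩

lemma block_approx {n u v kA kB kC : ℕ} (A B C X : Matrix (Fin n) (Fin n) ℝ)
    (hA : A.IsHermitian) (hB : B.IsHermitian)
    (a b : ℝ) (ha : 0 < a) (hab : a < b)
    (hAs : spectrum ℝ A ⊆ Set.Icc a b) (hBs : spectrum ℝ B ⊆ Set.Icc a b)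
    (hX : A * X + X * B = C)
    (k : ℕ) (hk : k = kA + kB + kC)
    (ρ : ℝ) (hρ : ρ = Real.exp (Real.pi ^ 2 / (2 * Real.log (4 * b / a))))
    (f : Fin u → Fin n) (g : Fin v → Fin n) (hf : Function.Injective f)
    (hg : Function.Injective g)
    (hsum : ∀ h : Fin n → ℝ, ∑ i, h i = ∑ i, h (f i) + ∑ i, h (g i))
    (rA : (A.submatrix f g).rank ≤ kA) (rB : (B.submatrix f g).rank ≤ kB)
    (rC : (C.submatrix f g).rank ≤ kC) (l : ℕ) (hl : 1 ≤ l) :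
    ∃ M : Matrix (Fin u) (Fin v) ℝ, M.rank ≤ k * l ∧
        specNorm (X.submatrix f g - M) ≤
          4 * ρ ^ (-(2 * (l : ℤ))) * specNorm (X.submatrix f g) := by
  obtain ⟨p, hp, hz⟩ := zolotarev ha hab hρ hl
  have sA := spectrum_submatrix A hA hAs f hf
  have sB := spectrum_submatrix B hB hBs g hg
  set Y := X.submatrix f g with hY
  have hD : A.submatrix f f * Y + Y * B.submatrix g g =
      C.submatrix f g - A.submatrix f g * X.submatrix g g - X.submatrix f f * B.submatrix f g := by
    rw [← hX]
    ext i j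
    simp only [hY, Matrix.add_apply, Matrix.sub_apply, Matrix.mul_apply, Matrix.submatrix_apply]
    rw [hsum (fun t => A (f i) t * X t (g j)), hsum (fun t => X (f i) t * B t (g j))]
    ring
  have hDr : (A.submatrix f f * Y + Y * B.submatrix g g).rank ≤ k := by
    rw [hD]
    have i1 := rank_sub_le' (C.submatrix f g - A.submatrix f g * X.submatrix g g)
      (X.submatrix f f * B.submatrix f g)
    have i2 := rank_sub_le' (C.submatrix f g) (A.submatrix f g * X.submatrix g g)
    have i3 := Matrix.rank_mul_le_left (A.submatrix f g) (X.submatrix g g)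
    have i4 := Matrix.rank_mul_le_right (X.submatrix f f) (B.submatrix f g)
    omega
  obtain ⟨E, hE, -, hr⟩ := adi_iter (A.submatrix f f) (B.submatrix g g) (hA.submatrix f)
    (hB.submatrix g) (fun x hx => ha.trans_le (sA hx).1) (fun x hx => ha.trans_le (sB hx).1)
    p hp Y hDr l
  refine ⟨Y - E, hr, ?_⟩
  rw [sub_sub_cancel, specNorm_eq, specNorm_eq, hE]
  have hρ0 : 0 < ρ := by rw [hρ]; exact Real.exp_pos _
  have hc0 : 0 ≤ 2 * (ρ ^ l)⁻¹ := by positivity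
  have nA : ‖cfc (fun x : ℝ => ∏ j ∈ Finset.range l, ((x - p j) / (x + p j)))
      (A.submatrix f f)‖ ≤ 2 * (ρ ^ l)⁻¹ :=
    norm_cfc_le hc0 fun x hx => hz x (sA hx)
  have nB : ‖cfc (fun x : ℝ => ∏ j ∈ Finset.range l, ((x - p j) / (x + p j)))
      (B.submatrix g g)‖ ≤ 2 * (ρ ^ l)⁻¹ :=
    norm_cfc_le hc0 fun x hx => hz x (sB hx)
  have e : (4 : ℝ) * ρ ^ (-(2 * (l : ℤ))) = (2 * (ρ ^ l)⁻¹) * (2 * (ρ ^ l)⁻¹) := by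
    have : ρ ^ (-(2 * (l : ℤ))) = (ρ ^ l)⁻¹ * (ρ ^ l)⁻¹ := by
      rw [_root_.zpow_neg, two_mul, zpow_add₀ hρ0.ne', zpow_natCast, mul_inv]
    rw [this]; ring
  rw [e]
  generalize cfc (fun x : ℝ => ∏ j ∈ Finset.range l, ((x - p j) / (x + p j)))
      (A.submatrix f f) = RA at nA ⊢
  generalize cfc (fun x : ℝ => ∏ j ∈ Finset.range l, ((x - p j) / (x + p j)))
      (B.submatrix g g) = RB at nB ⊢
  calc ‖RA * Y * RB‖ ≤ ‖RA * Y‖ * ‖RB‖ := Matrix.l2_opNorm_mul _ _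
    _ ≤ ‖RA‖ * ‖Y‖ * ‖RB‖ := by
        gcongr
        exact Matrix.l2_opNorm_mul _ _
    _ ≤ (2 * (ρ ^ l)⁻¹) * ‖Y‖ * (2 * (ρ ^ l)⁻¹) := by gcongr
    _ = _ := by ring

lemma sum_split {n p m : ℕ} (h : p + m = n) (F : Fin n → ℝ) :
    ∑ i, F i = ∑ i : Fin p, F ⟨i.1, by have := i.2; omega⟩ +
      ∑ i : Fin m, F ⟨p + i.1, by have := i.2; omega⟩ := by
  subst h
  rw [Fin.sum_univ_add]
  rfl

end MatrixPart

end Helpers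

/-- **Quasiseparable structure of solutions of SPD quasiseparable Sylvester equations.**
If `A`, `B` are symmetric positive definite of quasiseparable rank at most `k_A`, `k_B`, with
spectra in `[a,b]`, `0 < a < b`, and `AX + XB = C` with `C` of quasiseparable rank at most `k_C`,
then with `k = k_A + k_B + k_C` and `ρ = exp(π² / (2 log(4b/a)))`, every off-diagonal block `Y`
of `X` admits, for every `ℓ ≥ 1`, a matrix of rank at most `k·ℓ` within `4 ρ^(-2ℓ) ‖Y‖₂` of `Y`
in the spectral norm. -/
theorem sylvester_quasisep_offdiag_low_rank_approx
    {n kA kB kC : ℕ} (A B C X : Matrix (Fin n) (Fin n) ℝ)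
    (hA : A.PosDef) (hB : B.PosDef)
    (hAqs : QSRankLE A kA) (hBqs : QSRankLE B kB)
    (a b : ℝ) (ha : 0 < a) (hab : a < b)
    (hAs : spectrum ℝ A ⊆ Set.Icc a b) (hBs : spectrum ℝ B ⊆ Set.Icc a b)
    (hX : A * X + X * B = C) (hCqs : QSRankLE C kC)
    (k : ℕ) (hk : k = kA + kB + kC)
    (ρ : ℝ) (hρ : ρ = Real.exp (Real.pi ^ 2 / (2 * Real.log (4 * b / a)))) :
    ∀ (p : ℕ), 1 ≤ p → ∀ hp : p < n, ∀ ℓ : ℕ, 1 ≤ ℓ →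
      (∃ M : Matrix (Fin (n - p)) (Fin p) ℝ, M.rank ≤ k * ℓ ∧
        specNorm (lowerBlock X p hp - M) ≤
          4 * ρ ^ (-(2 * (ℓ : ℤ))) * specNorm (lowerBlock X p hp)) ∧
      (∃ M : Matrix (Fin p) (Fin (n - p)) ℝ, M.rank ≤ k * ℓ ∧
        specNorm (upperBlock X p hp - M) ≤
          4 * ρ ^ (-(2 * (ℓ : ℤ))) * specNorm (upperBlock X p hp)) := by
  intro p _ hp l hl
  have inj1 : Function.Injective
      (fun j : Fin p => (⟨j.1, by have := j.2; omega⟩ : Fin n)) := by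
    intro i j h
    simpa [Fin.ext_iff] using h
  have inj2 : Function.Injective
      (fun j : Fin (n - p) => (⟨p + j.1, by have := j.2; omega⟩ : Fin n)) := by
    intro i j h
    simpa [Fin.ext_iff] using h
  have hs := sum_split (n := n) (p := p) (m := n - p) (by omega)
  have lt : ∀ (i : Fin (n - p)) (j : Fin p), j.1 < p + i.1 := by
    intro i j
    have := j.2
    omega
  constructor
  · exact block_approx A B C X hA.isHermitian hB.isHermitian a b ha hab hAs hBs hX k hk ρ hρ
      _ _ inj2 inj1 (fun F => by rw [hs F, add_comm])
      (hAqs.1 _ _ _ _ fun i j => lt i j) (hBqs.1 _ _ _ _ fun i j => lt i j)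
      (hCqs.1 _ _ _ _ fun i j => lt i j) l hl
  · exact block_approx A B C X hA.isHermitian hB.isHermitian a b ha hab hAs hBs hX k hk ρ hρ
      _ _ inj1 inj2 (fun F => hs F)
      (hAqs.2 _ _ _ _ fun i j => lt j i) (hBqs.2 _ _ _ _ fun i j => lt j i)
      (hCqs.2 _ _ _ _ fun i j => lt j i) l hl
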